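/- arXiv:2006.16237 — 2 statements merged into one kernel-verified Lean document; each statement's English description precedes it below -/
import Mathlib

section
/- Assume α, β, γ are positive irrational numbers with α + β + γ = 1, β < 1/2 and α < γ, and let W̃_β be as defined in the context, with E_β(n) = W̃_β(n) − W_β(n) the difference of counting functions. Then for every n ∈ ℕ, E_β(n) ∈ {−1, 0, 1}; moreover E_β(n) = 1 if u_n > 1 − α and v_n > 1 − β/2; E_β(n) = −1 if u_n < α and v_n < β/2; and E_β(n) = 0 otherwise. -/
/-- The `n`-th term of the Webster sequence of density `d`: `⌈(n - 1/2)/d⌉`. -/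
noncomputable def wTerm (d : ℝ) (n : ℕ) : ℕ := ⌈((n : ℝ) - 1/2) / d⌉₊

/-- The Webster sequence of density `d`, as a set of positive integers. -/
def wSet (d : ℝ) : Set ℕ := {m : ℕ | ∃ n : ℕ, 1 ≤ n ∧ m = wTerm d n}

/-- Counting function of a set of positive integers: `S(m) = #{k ∈ S : k ≤ m}`. -/
noncomputable def wCount (S : Set ℕ) (m : ℕ) : ℕ := (S ∩ Set.Iic m).ncard

/-- `u_n = {nd + 1/2}` (fractional part), for density `d`. -/
noncomputable def fpart (d : ℝ) (n : ℕ) : ℝ := Int.fract ((n : ℝ) * d + 1/2)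

/-- The set `W̃_β` of Algorithm 2. -/
def WtB (α β : ℝ) : Set ℕ := {n : ℕ | 1 ≤ n ∧
  ((α < fpart α n ∧ fpart β n < β) ∨
   (1 - α < fpart α n ∧ 1 - β/2 < fpart β n) ∨
   (α < fpart α n ∧ fpart α n < 2*α ∧ β < fpart β n ∧ fpart β n < 3*β/2))}

/-- `E_β(n) = W̃_β(n) − W_β(n)`. -/
noncomputable def Ebeta (α β : ℝ) (n : ℕ) : ℤ :=
  (wCount (WtB α β) n : ℤ) - (wCount (wSet β) n : ℤ)

theorem wCount_zero {S : Set ℕ} (h : 0 ∉ S) : wCount S 0 = 0 := by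
  have : S ∩ Set.Iic 0 = ∅ := by
    ext k
    simp only [Set.mem_inter_iff, Set.mem_Iic, nonpos_iff_eq_zero, Set.mem_empty_iff_false,
      iff_false, not_and]
    rintro hk rfl
    exact h hk
  simp [wCount, this]

theorem wCount_succ_of_mem {S : Set ℕ} {n : ℕ} (h : n + 1 ∈ S) :
    wCount S (n + 1) = wCount S n + 1 := by
  have : S ∩ Set.Iic (n + 1) = insert (n + 1) (S ∩ Set.Iic n) := by
    ext k
    simp only [Set.mem_inter_iff, Set.mem_Iic, Set.mem_insert_iff]
    grind
  rw [wCount, this, Set.ncard_insert_of_notMem (by simp)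
    ((Set.finite_Iic n).subset Set.inter_subset_right), wCount]

theorem wCount_succ_of_notMem {S : Set ℕ} {n : ℕ} (h : n + 1 ∉ S) :
    wCount S (n + 1) = wCount S n := by
  have : S ∩ Set.Iic (n + 1) = S ∩ Set.Iic n := by
    ext k
    simp only [Set.mem_inter_iff, Set.mem_Iic]
    grind
  rw [wCount, this, wCount]

theorem zero_notMem_wSet {d : ℝ} (hd : 0 < d) : 0 ∉ wSet d := by
  rintro ⟨k, hk, h⟩
  have hk' : (1 : ℝ) ≤ k := by exact_mod_cast hk
  have : 0 < wTerm d k := Nat.ceil_pos.mpr (div_pos (by linarith) hd)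
  omega

/-- A positive integer belongs to the Webster sequence of density `d` iff the rotation by `d`,
started at `1/2`, has just completed a turn. -/
theorem succ_mem_wSet_iff {d : ℝ} (hd : 0 < d) (n : ℕ) :
    n + 1 ∈ wSet d ↔ fpart d (n + 1) < d := by
  have key (k : ℕ) :
      n + 1 = wTerm d k ↔ (n : ℝ) * d < k - 1 / 2 ∧ (k : ℝ) - 1 / 2 ≤ (n + 1) * d := by
    rw [eq_comm, wTerm, Nat.ceil_eq_iff (Nat.succ_ne_zero n), lt_div_iff₀ hd, div_le_iff₀ hd]
    simp
  have hnd : 0 ≤ (n : ℝ) * d := by positivity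
  constructor
  · rintro ⟨k, -, h⟩
    obtain ⟨h₁, h₂⟩ := (key k).1 h
    have hfl : (k : ℤ) ≤ ⌊((n + 1 : ℕ) : ℝ) * d + 1 / 2⌋ := by
      rw [Int.le_floor]; push_cast; linarith
    have hfl' : (k : ℝ) ≤ ⌊((n + 1 : ℕ) : ℝ) * d + 1 / 2⌋ := by exact_mod_cast hfl
    rw [fpart, Int.fract]
    push_cast at hfl' ⊢
    linarith
  · intro h
    obtain ⟨k, hk⟩ := Int.eq_ofNat_of_zero_le
      (Int.floor_nonneg.2 (by positivity : 0 ≤ ((n + 1 : ℕ) : ℝ) * d + 1 / 2))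
    have h₀ := Int.fract_nonneg (((n + 1 : ℕ) : ℝ) * d + 1 / 2)
    rw [fpart] at h
    rw [Int.fract, hk] at h h₀
    push_cast at h h₀
    have hk₀ : (0 : ℝ) < k := by linarith
    exact ⟨k, by exact_mod_cast hk₀, (key k).2 ⟨by linarith, by linarith⟩⟩

theorem fpart_nonneg (d : ℝ) (n : ℕ) : 0 ≤ fpart d n := Int.fract_nonneg _

theorem fpart_lt_one (d : ℝ) (n : ℕ) : fpart d n < 1 := Int.fract_lt_one _

theorem fpart_zero (d : ℝ) : fpart d 0 = 1 / 2 := by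
  simp only [fpart, Nat.cast_zero, zero_mul, zero_add]
  exact Int.fract_eq_self.2 ⟨by norm_num, by norm_num⟩

theorem fpart_succ {d : ℝ} (hd : 0 < d) (hd1 : d < 1) (n : ℕ) :
    fpart d (n + 1) = fpart d n + d ∨ fpart d (n + 1) = fpart d n + d - 1 := by
  have h₀ := fpart_nonneg d n
  have h₁ := fpart_lt_one d n
  have hstep : fpart d (n + 1) = Int.fract (fpart d n + d) := by
    rw [fpart, fpart, Int.fract_eq_fract]
    refine ⟨⌊(n : ℝ) * d + 1 / 2⌋, ?_⟩
    rw [Int.fract]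
    push_cast
    ring
  rcases lt_or_ge (fpart d n + d) 1 with h | h
  · exact .inl (hstep.trans (Int.fract_eq_self.2 ⟨by linarith, h⟩))
  · right
    rw [hstep, ← Int.fract_sub_one]
    exact Int.fract_eq_self.2 ⟨by linarith, by linarith⟩

theorem fpart_ne {d : ℝ} (hd : Irrational d) (n : ℕ) (k : ℤ) (r : ℚ) :
    fpart d n ≠ k + r * d := by
  intro h
  rw [fpart, Int.fract] at h
  set m := ⌊(n : ℝ) * d + 1 / 2⌋
  have h' : (((n : ℚ) - r : ℚ) : ℝ) * d = ((k + m - 1 / 2 : ℚ) : ℝ) := by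
    push_cast; linarith
  by_cases hr : (n : ℚ) - r = 0
  · rw [hr, Rat.cast_zero, zero_mul] at h'
    have h2 : (2 * (k + m) : ℚ) = 1 := by
      have : (k + m - 1 / 2 : ℚ) = 0 := by exact_mod_cast h'.symm
      linarith
    have h3 : 2 * (k + m) = 1 := by exact_mod_cast h2
    omega
  · exact (hd.ratCast_mul hr).ne_rat _ h'

theorem succ_mem_WtB_iff (α β : ℝ) (n : ℕ) :
    n + 1 ∈ WtB α β ↔
      (α < fpart α (n + 1) ∧ fpart β (n + 1) < β) ∨
      (1 - α < fpart α (n + 1) ∧ 1 - β / 2 < fpart β (n + 1)) ∨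
      (α < fpart α (n + 1) ∧ fpart α (n + 1) < 2 * α ∧
        β < fpart β (n + 1) ∧ fpart β (n + 1) < 3 * β / 2) :=
  and_iff_right (Nat.le_add_left 1 n)

open Classical in
/-- The value of `E_β(n)` predicted by the positions `u`, `v` of the two rotations. -/
noncomputable def errorValue (α β u v : ℝ) : ℤ :=
  if 1 - α < u ∧ 1 - β / 2 < v then 1 else if u < α ∧ v < β / 2 then -1 else 0

theorem Ebeta_zero {α β : ℝ} (hβ : 0 < β) : Ebeta α β 0 = 0 := by
  rw [Ebeta, wCount_zero (zero_notMem_wSet hβ), wCount_zero (fun h => absurd h.1 (by simp))]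
  simp

open Classical in
theorem Ebeta_succ {α β : ℝ} (hβ : 0 < β) (n : ℕ) :
    Ebeta α β (n + 1) = Ebeta α β n + (if n + 1 ∈ WtB α β then 1 else 0) -
      (if fpart β (n + 1) < β then 1 else 0) := by
  have hW := succ_mem_wSet_iff hβ n
  by_cases h₁ : n + 1 ∈ WtB α β <;> by_cases h₂ : fpart β (n + 1) < β
  · simp [Ebeta, h₁, h₂, wCount_succ_of_mem h₁, wCount_succ_of_mem (hW.2 h₂)]
  · simp [Ebeta, h₁, h₂, wCount_succ_of_mem h₁, wCount_succ_of_notMem (mt hW.1 h₂)]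
    ring
  · simp [Ebeta, h₁, h₂, wCount_succ_of_notMem h₁, wCount_succ_of_mem (hW.2 h₂)]
    ring
  · simp [Ebeta, h₁, h₂, wCount_succ_of_notMem h₁, wCount_succ_of_notMem (mt hW.1 h₂)]

theorem Ebeta_eq_errorValue {α β : ℝ} (hα : 0 < α) (hβ : 0 < β) (hαi : Irrational α)
    (hβi : Irrational β) (hα2 : α < 1 / 2) (hβ2 : β < 1 / 2) (n : ℕ) :
    Ebeta α β n = errorValue α β (fpart α n) (fpart β n) := by
  induction n with
  | zero =>
    rw [Ebeta_zero hβ, fpart_zero, fpart_zero, errorValue, if_neg, if_neg] <;>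
      (rintro ⟨_, _⟩; linarith)
  | succ n ih =>
    have hu := fpart_succ hα (by linarith) n
    have hv := fpart_succ hβ (by linarith) n
    have hu₀ := fpart_nonneg α n
    have hu₁ := fpart_lt_one α n
    have hv₀ := fpart_nonneg β n
    have hv₁ := fpart_lt_one β n
    have hu₀' := fpart_nonneg α (n + 1)
    have hu₁' := fpart_lt_one α (n + 1)
    have hv₀' := fpart_nonneg β (n + 1)
    have hv₁' := fpart_lt_one β (n + 1)
    have hne₁ : fpart α (n + 1) ≠ α := by simpa using fpart_ne hαi (n + 1) 0 1
    have hne₀ : fpart α (n + 1) ≠ 0 := by simpa using fpart_ne hαi (n + 1) 0 0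
    have hne₂ : fpart β (n + 1) ≠ β := by simpa using fpart_ne hβi (n + 1) 0 1
    have hne₃ : fpart β (n + 1) ≠ β / 2 := by
      have := fpart_ne hβi (n + 1) 0 (1 / 2)
      push_cast at this
      intro h; exact this (by linarith)
    have hmem := succ_mem_WtB_iff α β n
    rw [Ebeta_succ hβ, ih, errorValue, errorValue]
    clear ih
    generalize fpart α (n + 1) = u' at *
    generalize fpart β (n + 1) = v' at *
    generalize fpart α n = u at *
    generalize fpart β n = v at *
    grind

/-- Characterization of the counting-function error `E_β(n)`. -/
theorem Ebeta_characterization (α β γ : ℝ)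
    (hα : 0 < α) (hβ : 0 < β) (hγ : 0 < γ)
    (hαi : Irrational α) (hβi : Irrational β) (hγi : Irrational γ)
    (hsum : α + β + γ = 1) (hβhalf : β < 1/2) (hαγ : α < γ) :
    ∀ n : ℕ, 1 ≤ n →
      (Ebeta α β n = -1 ∨ Ebeta α β n = 0 ∨ Ebeta α β n = 1) ∧
      ((1 - α < fpart α n ∧ 1 - β/2 < fpart β n) → Ebeta α β n = 1) ∧
      ((fpart α n < α ∧ fpart β n < β/2) → Ebeta α β n = -1) ∧
      (¬(1 - α < fpart α n ∧ 1 - β/2 < fpart β n) →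
        ¬(fpart α n < α ∧ fpart β n < β/2) → Ebeta α β n = 0) := by
  intro n _
  rw [Ebeta_eq_errorValue hα hβ hαi hβi (by linarith) hβhalf, errorValue]
  have hdisj : 1 - α < fpart α n → ¬ fpart α n < α := fun _ => by linarith
  grind
end

section
/- Assume α, β, γ are positive irrational numbers with α + β + γ = 1, β < 1/2 and α < γ, and let W̃_γ, c, c̃ be as defined in the context. For n ∈ ℕ put m = c̃(n). Then c(n) − c̃(n) ∈ {−1, 0, 1}, and: c(n) − c̃(n) = −1 if u_m > α and v_m > β and (u_m > 2α or v_m > 3β/2) and u_m + v_m < 3/2 − γ; c(n) − c̃(n) = 0 if u_m > α and v_m > β and 3/2 − γ < u_m + v_m < 3/2; and c(n) − c̃(n) = 1 if 3/2 < u_m + v_m < 2 and (u_m < 1 − α or v_m < 1 − β/2). -/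
/-- The set `W̃_α` of Algorithm 2. -/
def WtA (α : ℝ) : Set ℕ := {n : ℕ | 1 ≤ n ∧ fpart α n < α}

/-- The set `W̃_γ` of Algorithm 2. -/
def WtC (α β : ℝ) : Set ℕ := {n : ℕ | 1 ≤ n} \ (WtA α ∪ WtB α β)

/-- The `n`-th smallest element (1-indexed) of a set of naturals. -/
noncomputable def nthElt (S : Set ℕ) (n : ℕ) : ℕ := Nat.nth (· ∈ S) (n - 1)

theorem floor_add_fpart (d : ℝ) (n : ℕ) :
    (⌊(n : ℝ) * d + 1/2⌋ : ℝ) + fpart d n = n * d + 1/2 :=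
  Int.floor_add_fract _

/-- An integer multiple of an irrational number is never an odd integer. -/
theorem Irrational.intCast_mul_ne_odd {d : ℝ} (hd : Irrational d) (a b : ℤ) :
    (a : ℝ) * d ≠ 2 * b + 1 := by
  intro h
  by_cases ha : a = 0
  · subst ha
    have h' : (0 : ℤ) = 2 * b + 1 := by
      have : ((0 : ℤ) : ℝ) = ((2 * b + 1 : ℤ) : ℝ) := by push_cast; simpa using h
      exact_mod_cast this
    omega
  · apply (hd.intCast_mul ha).ne_int (2 * b + 1)
    push_cast
    exact h

/-- For irrational `d`, the fractional part `{n d + 1/2}` avoids integer translates of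
integer multiples of `d`. -/
theorem fpart_ne_mul_add {d : ℝ} (hd : Irrational d) (n : ℕ) (a b : ℤ) :
    fpart d n ≠ a * d + b := by
  intro h
  have h1 := floor_add_fpart d n
  apply hd.intCast_mul_ne_odd (2 * (n - a)) (⌊(n : ℝ) * d + 1/2⌋ + b - 1)
  push_cast
  linarith

/-- For irrational `d`, the fractional part `{n d + 1/2}` avoids integer translates of
half-odd multiples of `d`. -/
theorem fpart_ne_half_mul_add {d : ℝ} (hd : Irrational d) (n : ℕ) (a b : ℤ) :
    fpart d n ≠ (a + 1/2) * d + b := by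
  intro h
  have h1 := floor_add_fpart d n
  apply hd.intCast_mul_ne_odd (2 * (n - a) - 1) (⌊(n : ℝ) * d + 1/2⌋ + b - 1)
  push_cast
  linarith

/-- Passing from `n` to `n + 1` adds `d` to `{n d + 1/2}`, with a carry into the integer part
exactly when the sum reaches `1`. -/
theorem fpart_succ_s12 {d : ℝ} (h0 : 0 < d) (h1 : d < 1) (n : ℕ) :
    (fpart d n + d < 1 ∧ fpart d (n + 1) = fpart d n + d ∧
      ⌊((n + 1 : ℕ) : ℝ) * d + 1/2⌋ = ⌊(n : ℝ) * d + 1/2⌋) ∨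
    (1 ≤ fpart d n + d ∧ fpart d (n + 1) = fpart d n + d - 1 ∧
      ⌊((n + 1 : ℕ) : ℝ) * d + 1/2⌋ = ⌊(n : ℝ) * d + 1/2⌋ + 1) := by
  have e0 := floor_add_fpart d n
  have e1 := floor_add_fpart d (n + 1)
  have n0 := fpart_nonneg d n
  have l0 := fpart_lt_one d n
  rcases lt_or_ge (fpart d n + d) 1 with h | h
  · have hf : ⌊((n + 1 : ℕ) : ℝ) * d + 1/2⌋ = ⌊(n : ℝ) * d + 1/2⌋ := by
      rw [Int.floor_eq_iff]
      push_cast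
      constructor <;> linarith
    refine Or.inl ⟨h, ?_, hf⟩
    rw [hf] at e1
    push_cast at e1
    linarith
  · have hf : ⌊((n + 1 : ℕ) : ℝ) * d + 1/2⌋ = ⌊(n : ℝ) * d + 1/2⌋ + 1 := by
      rw [Int.floor_eq_iff]
      push_cast
      constructor <;> linarith
    refine Or.inr ⟨h, ?_, hf⟩
    rw [hf] at e1
    push_cast at e1
    linarith

open Classical in
/-- The counting function of `W̃_γ`: conflicts between the Webster sequences of densities
`α` and `β` contribute the two correction terms. -/
theorem count_WtC {α β : ℝ} (hα : 0 < α) (hβ : 0 < β) (hαi : Irrational α) (hβi : Irrational β)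
    (hα' : α < 1/2) (hβ' : β < 1/2) (m : ℕ) :
    (Nat.count (· ∈ WtC α β) (m + 1) : ℤ) =
      m - ⌊(m : ℝ) * α + 1/2⌋ - ⌊(m : ℝ) * β + 1/2⌋
        - (if 1 - α < fpart α m ∧ 1 - β/2 < fpart β m then 1 else 0)
        + (if fpart α m < α ∧ fpart β m < β/2 then 1 else 0) := by
  induction m with
  | zero =>
    have hu : fpart α 0 = 1/2 := by norm_num [fpart]
    have h2 : ¬ (1 - α < fpart α 0 ∧ 1 - β/2 < fpart β 0) := by
      rintro ⟨h, -⟩; linarith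
    have h3 : ¬ (fpart α 0 < α ∧ fpart β 0 < β/2) := by
      rintro ⟨h, -⟩; linarith
    rw [if_neg h2, if_neg h3, Nat.count_succ]
    norm_num [WtC]
  | succ m ih =>
    rw [Nat.count_succ, Nat.cast_add, ih]
    have hmem : m + 1 ∈ WtC α β ↔ ¬ (fpart α (m + 1) < α) ∧
        ¬ ((α < fpart α (m + 1) ∧ fpart β (m + 1) < β) ∨
          (1 - α < fpart α (m + 1) ∧ 1 - β/2 < fpart β (m + 1)) ∨
          (α < fpart α (m + 1) ∧ fpart α (m + 1) < 2*α ∧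
            β < fpart β (m + 1) ∧ fpart β (m + 1) < 3*β/2)) := by
      simp [WtC, WtA, WtB]
    have nu := fpart_nonneg α m
    have lu := fpart_lt_one α m
    have nv := fpart_nonneg β m
    have lv := fpart_lt_one β m
    have bu0 : fpart α m ≠ 0 := by simpa using fpart_ne_mul_add hαi m 0 0
    have bv0 : fpart β m ≠ 0 := by simpa using fpart_ne_mul_add hβi m 0 0
    have bv2 : fpart β m ≠ 1 - β/2 := by
      have := fpart_ne_half_mul_add hβi m (-1) 1
      intro h; apply this; push_cast; linarith
    have bu2 : fpart α m ≠ 1 - α := by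
      have := fpart_ne_mul_add hαi m (-1) 1
      intro h; apply this; push_cast; linarith
    rw [if_congr hmem rfl rfl]
    obtain ⟨hu, eu, fu⟩ | ⟨hu, eu, fu⟩ := fpart_succ_s12 hα (by linarith) m <;>
    obtain ⟨hv, ev, fv⟩ | ⟨hv, ev, fv⟩ := fpart_succ_s12 hβ (by linarith) m <;>
    rw [fu, fv, eu, ev] <;> clear fu fv eu ev hmem ih hαi hβi <;>
    generalize fpart α m = u at * <;>
    generalize fpart β m = v at * <;>
    push_cast
    all_goals grind

open Classical in
/-- `W̃_γ` is infinite. -/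
theorem infinite_WtC {α β : ℝ} (hα : 0 < α) (hβ : 0 < β) (hαi : Irrational α)
    (hβi : Irrational β) (hα' : α < 1/2) (hβ' : β < 1/2) : (WtC α β).Infinite := by
  intro hf
  have hpos : 0 < 1 - α - β := by linarith
  obtain ⟨m, hm⟩ := exists_nat_gt (((hf.toFinset.card : ℝ) + 2) / (1 - α - β))
  rw [div_lt_iff₀ hpos] at hm
  have hle : Nat.count (· ∈ WtC α β) (m + 1) ≤ hf.toFinset.card := by
    rw [Nat.count_eq_card_filter_range]
    exact Finset.card_le_card fun x hx => by simpa using (Finset.mem_filter.1 hx).2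
  have hc := count_WtC hα hβ hαi hβi hα' hβ' m
  have hc' : (m : ℤ) - ⌊(m : ℝ) * α + 1/2⌋ - ⌊(m : ℝ) * β + 1/2⌋ - 1 ≤ hf.toFinset.card := by
    have : (Nat.count (· ∈ WtC α β) (m + 1) : ℤ) ≤ hf.toFinset.card := by exact_mod_cast hle
    split_ifs at hc <;> linarith
  have hr : (m : ℝ) - ⌊(m : ℝ) * α + 1/2⌋ - ⌊(m : ℝ) * β + 1/2⌋ - 1 ≤ hf.toFinset.card := by
    exact_mod_cast hc'
  have ha := Int.floor_le ((m : ℝ) * α + 1/2)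
  have hb := Int.floor_le ((m : ℝ) * β + 1/2)
  linarith

open Classical in
/-- The rank of an element `m` of `W̃_γ`, expressed through the fractional parts at `m`. -/
theorem rank_of_mem_WtC {α β : ℝ} (hα : 0 < α) (hβ : 0 < β) (hαi : Irrational α)
    (hβi : Irrational β) (hα' : α < 1/2) (hβ' : β < 1/2) {n : ℕ} (hn : 1 ≤ n)
    (hm : nthElt (WtC α β) n ∈ WtC α β) :
    (n : ℝ) = nthElt (WtC α β) n * (1 - α - β) + fpart α (nthElt (WtC α β) n)
      + fpart β (nthElt (WtC α β) n) - 1 := by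
  have hcount : Nat.count (· ∈ WtC α β) (nthElt (WtC α β) n) = n - 1 :=
    Nat.count_nth_of_infinite (p := (· ∈ WtC α β)) (infinite_WtC hα hβ hαi hβi hα' hβ') _
  generalize nthElt (WtC α β) n = m at *
  have hc := count_WtC hα hβ hαi hβi hα' hβ' m
  rw [Nat.count_succ, hcount, if_pos hm, Nat.sub_add_cancel hn, if_neg, if_neg] at hc
  · have hc' : (n : ℝ) = m - ⌊(m : ℝ) * α + 1/2⌋ - ⌊(m : ℝ) * β + 1/2⌋ := by
      have : (n : ℤ) = m - ⌊(m : ℝ) * α + 1/2⌋ - ⌊(m : ℝ) * β + 1/2⌋ := by linarith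
      exact_mod_cast this
    have ha := floor_add_fpart α m
    have hb := floor_add_fpart β m
    linarith
  · rintro ⟨h, -⟩
    exact hm.2 (Or.inl ⟨hm.1, h⟩)
  · rintro h
    exact hm.2 (Or.inr ⟨hm.1, Or.inr (Or.inl h)⟩)

/-- The `n`-th Webster term of density `d` is the integer `k` bracketed by `(n - 1/2)/d`. -/
theorem wTerm_eq {d : ℝ} (hd : 0 < d) {n : ℕ} {k : ℤ} (hn : 1 ≤ n)
    (h1 : (k - 1) * d < n - 1/2) (h2 : (n : ℝ) - 1/2 ≤ k * d) : (wTerm d n : ℤ) = k := by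
  have hn' : (1 : ℝ) ≤ n := by exact_mod_cast hn
  have h0 : 0 ≤ ((n : ℝ) - 1/2) / d := div_nonneg (by linarith) hd.le
  rw [wTerm, Int.natCast_ceil_eq_ceil h0, Int.ceil_eq_iff, lt_div_iff₀ hd, div_le_iff₀ hd]
  exact ⟨h1, h2⟩

/-- Characterization of the perturbation error `c(n) − c̃(n)` in terms of
the fractional parts `u_m, v_m` at `m = c̃(n)`. -/
theorem c_error_uv_characterization (α β γ : ℝ)
    (hα : 0 < α) (hβ : 0 < β) (hγ : 0 < γ)
    (hαi : Irrational α) (hβi : Irrational β) (hγi : Irrational γ)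
    (hsum : α + β + γ = 1) (hβhalf : β < 1/2) (hαγ : α < γ) :
    ∀ n : ℕ, 1 ≤ n →
      ∀ m : ℕ, m = nthElt (WtC α β) n →
        ((wTerm γ n : ℤ) - (m : ℤ) = -1 ∨ (wTerm γ n : ℤ) - (m : ℤ) = 0 ∨
          (wTerm γ n : ℤ) - (m : ℤ) = 1) ∧
        ((α < fpart α m ∧ β < fpart β m ∧
            (2*α < fpart α m ∨ 3*β/2 < fpart β m) ∧
            fpart α m + fpart β m < 3/2 - γ) →
          (wTerm γ n : ℤ) - (m : ℤ) = -1) ∧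
        ((α < fpart α m ∧ β < fpart β m ∧
            3/2 - γ < fpart α m + fpart β m ∧ fpart α m + fpart β m < 3/2) →
          (wTerm γ n : ℤ) - (m : ℤ) = 0) ∧
        ((3/2 < fpart α m + fpart β m ∧ fpart α m + fpart β m < 2 ∧
            (fpart α m < 1 - α ∨ fpart β m < 1 - β/2)) →
          (wTerm γ n : ℤ) - (m : ℤ) = 1) := by
  intro n hn m hm
  have hα' : α < 1/2 := by linarith
  have hmem : m ∈ WtC α β := by
    rw [hm]
    exact Nat.nth_mem_of_infinite (infinite_WtC hα hβ hαi hβi hα' hβhalf) _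
  have hrank := rank_of_mem_WtC hα hβ hαi hβi hα' hβhalf hn (hm ▸ hmem)
  rw [← hm, show 1 - α - β = γ by linarith] at hrank
  have lu := fpart_lt_one α m
  have lv := fpart_lt_one β m
  have bu1 : fpart α m ≠ α := by simpa using fpart_ne_mul_add hαi m 1 0
  have bv1 : fpart β m ≠ β := by simpa using fpart_ne_mul_add hβi m 1 0
  have hA : α < fpart α m :=
    lt_of_le_of_ne (not_lt.1 fun h => hmem.2 (Or.inl ⟨hmem.1, h⟩)) bu1.symm
  have hnB : ¬ _ := fun h => hmem.2 (Or.inr ⟨hmem.1, h⟩)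
  have hB : β < fpart β m :=
    lt_of_le_of_ne (not_lt.1 fun h => hnB (Or.inl ⟨hA, h⟩)) bv1.symm
  have hlow : 2 * α ≤ fpart α m ∨ 3 * β/2 ≤ fpart β m := by
    by_contra! h
    exact hnB (Or.inr (Or.inr ⟨hA, h.1, hB, h.2⟩))
  have hhigh : fpart α m ≤ 1 - α ∨ fpart β m ≤ 1 - β/2 := by
    by_contra! h
    exact hnB (Or.inr (Or.inl h))
  have minus : 3/2 - 2 * γ < fpart α m + fpart β m → fpart α m + fpart β m ≤ 3/2 - γ →
      (wTerm γ n : ℤ) - m = -1 := fun h1 h2 => by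
    rw [wTerm_eq (k := m - 1) hγ hn] <;> push_cast <;> linarith
  have zero : 3/2 - γ < fpart α m + fpart β m → fpart α m + fpart β m ≤ 3/2 →
      (wTerm γ n : ℤ) - m = 0 := fun h1 h2 => by
    rw [wTerm_eq (k := m) hγ hn] <;> push_cast <;> linarith
  have plus : 3/2 < fpart α m + fpart β m → fpart α m + fpart β m ≤ 3/2 + γ →
      (wTerm γ n : ℤ) - m = 1 := fun h1 h2 => by
    rw [wTerm_eq (k := m + 1) hγ hn] <;> push_cast <;> linarith
  have lower : 3/2 - 2 * γ < fpart α m + fpart β m := by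
    rcases hlow with h | h <;> linarith
  have upper : fpart α m + fpart β m ≤ 3/2 + γ := by
    rcases hhigh with h | h <;> linarith
  refine ⟨?_, fun h => minus lower h.2.2.2.le, fun h => zero h.2.2.1 h.2.2.2.le,
    fun h => plus h.1 upper⟩
  rcases le_or_gt (fpart α m + fpart β m) (3/2 - γ) with h | h
  · exact Or.inl (minus lower h)
  · rcases le_or_gt (fpart α m + fpart β m) (3/2) with h' | h'
    · exact Or.inr (Or.inl (zero h h'))
    · exact Or.inr (Or.inr (plus h' upper))
end
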